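/- Every u ∈ k is equivalent modulo ℘(k) = {w² + w : w ∈ k} to a unique element of the normalized form Σ_{i=1}^{m} Σ_{j=1}^{e_i} Q_{ij}/P_i^{2j−1} + Σ_{ℓ=1}^{n} α_ℓ T^{2ℓ−1} + α, where the P_i are distinct monic irreducible polynomials in F_q[T], Q_{ij} ∈ F_q[T] with deg Q_{ij} < deg P_i, Q_{i e_i} ≠ 0 for each i, α ∈ {0, ξ}, α_ℓ ∈ F_q, and α_n ≠ 0 whenever n > 0. (Equivalently, every separable quadratic extension K_u = k(x_u) of k, where x_u² + x_u = u ∈ k, arises from exactly one normalized u.) -/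

import Mathlib

open Polynomial

noncomputable section

namespace EvenChar

/-- The set of rational functions in normalized form
`Σ_{i=1}^{m} Σ_{j=1}^{e_i} Q_{ij}/P_i^{2j-1} + Σ_{ℓ=1}^{n} α_ℓ T^{2ℓ-1} + α`,
where the `P_i` are distinct monic irreducibles, `deg Q_{ij} < deg P_i`,
`Q_{i e_i} ≠ 0`, `α ∈ {0, ξ}`, and `α_n ≠ 0` whenever `n > 0`. -/
def NormalForm {Fq : Type} [Field Fq] (ξ : Fq) : Set (RatFunc Fq) :=
  { v | ∃ (S : Finset (Polynomial Fq)) (e : Polynomial Fq → ℕ)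
        (Q : Polynomial Fq → ℕ → Polynomial Fq) (n : ℕ) (a : ℕ → Fq) (α : Fq),
      (∀ P ∈ S, P.Monic ∧ Irreducible P) ∧
      (∀ P ∈ S, 1 ≤ e P) ∧
      (∀ P ∈ S, ∀ j, 1 ≤ j → j ≤ e P → (Q P j).degree < P.degree) ∧
      (∀ P ∈ S, Q P (e P) ≠ 0) ∧
      (α = 0 ∨ α = ξ) ∧
      (0 < n → a n ≠ 0) ∧
      v = (∑ P ∈ S, ∑ j ∈ Finset.Icc 1 (e P),
            algebraMap (Polynomial Fq) (RatFunc Fq) (Q P j) /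
              algebraMap (Polynomial Fq) (RatFunc Fq) P ^ (2 * j - 1)) +
          algebraMap (Polynomial Fq) (RatFunc Fq)
            ((∑ l ∈ Finset.Icc 1 n, C (a l) * X ^ (2 * l - 1)) + C α) }

section
variable {F : Type} [Field F]

local notation "ι" => algebraMap (Polynomial F) (RatFunc F)

/-- The additive subgroup generated by the basic normalized pieces. -/
def gens (ξ : F) : Set (RatFunc F) :=
  { v | (∃ (P Q : Polynomial F) (j : ℕ), P.Monic ∧ Irreducible P ∧ Q.degree < P.degree ∧ 1 ≤ j ∧
      v = ι Q / ι P ^ (2 * j - 1)) ∨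
    (∃ (c : F) (l : ℕ), 1 ≤ l ∧ v = ι (C c * X ^ (2 * l - 1))) ∨ v = ι (C ξ) }

/-- The Artin-Schreier map. -/
def wp [CharP F 2] : RatFunc F →+ RatFunc F where
  toFun w := w ^ 2 + w
  map_zero' := by simp
  map_add' x y := by
    have : CharP (RatFunc F) 2 := charP_of_injective_algebraMap (algebraMap F (RatFunc F)).injective 2
    rw [CharTwo.add_sq]; ring

def H [CharP F 2] (ξ : F) : AddSubgroup (RatFunc F) := AddSubgroup.closure (gens ξ) ⊔ wp.range

variable [CharP F 2] 

lemma gens_mem {ξ : F} {v} (h : v ∈ gens ξ) : v ∈ H ξ :=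
  AddSubgroup.mem_sup_left (AddSubgroup.subset_closure h)

lemma wp_mem {ξ : F} (w : RatFunc F) : w ^ 2 + w ∈ H ξ :=
  AddSubgroup.mem_sup_right ⟨w, rfl⟩

lemma sq_mem {ξ : F} {w : RatFunc F} (h : w ∈ H ξ) : w ^ 2 ∈ H ξ := by
  have := (H ξ).sub_mem (wp_mem w) h
  simpa using this

lemma exists_sq [Finite F] (c : F) : ∃ b : F, b ^ 2 = c := by
  obtain ⟨b, hb⟩ := (Finite.injective_iff_surjective.mp (frobenius_inj F 2)) c
  exact ⟨b, by simpa [frobenius_def] using hb⟩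

lemma const_cases [Finite F] {ξ : F} (hξ : ∀ x : F, x ^ 2 + x ≠ ξ) (c : F) :
    ∃ x, c = x ^ 2 + x ∨ c = x ^ 2 + x + ξ := by
  let f : F →+ F := ⟨⟨fun x => x ^ 2 + x, by simp⟩, fun x y => by
    simp only []; rw [CharTwo.add_sq]; ring⟩
  have hker : Nat.card f.ker ≤ 2 := by
    have : (f.ker : Set F) ⊆ {0, 1} := by
      intro x hx
      have hx : x ^ 2 + x = 0 := hx
      have : x * (x + 1) = 0 := by rw [← hx]; ring
      rcases mul_eq_zero.mp this with h | h
      · simp [h]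
      · right; exact (CharTwo.add_eq_zero.mp h)
    calc Nat.card f.ker = (f.ker : Set F).ncard := rfl
      _ ≤ ({0, 1} : Set F).ncard := Set.ncard_le_ncard this (by simp)
      _ ≤ 2 := Set.ncard_insert_le _ _ |>.trans (by simp)
  have h1 : f.range.index * Nat.card f.range = Nat.card F := f.range.index_mul_card
  have h2 : f.ker.index * Nat.card f.ker = Nat.card F := f.ker.index_mul_card
  have h3 : f.ker.index = Nat.card f.range := AddSubgroup.index_ker f
  have hpos : 0 < Nat.card f.range := Nat.card_pos
  have hidx : f.range.index ≤ 2 := by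
    rw [h3] at h2
    have : f.range.index = Nat.card f.ker := by
      apply Nat.eq_of_mul_eq_mul_right hpos
      rw [h1, ← h2, mul_comm]
    omega
  have hne : f.range.index ≠ 1 := by
    intro h
    rw [AddSubgroup.index_eq_one] at h
    have : ξ ∈ f.range := h ▸ AddSubgroup.mem_top _
    obtain ⟨x, hx⟩ := this
    exact hξ x hx
  have h0 : f.range.index ≠ 0 := AddSubgroup.index_ne_zero_of_finite
  have h22 : f.range.index = 2 := by omega
  by_cases hc : c ∈ f.range
  · obtain ⟨x, hx⟩ := hc
    exact ⟨x, Or.inl hx.symm⟩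
  · have hξ' : ξ ∉ f.range := fun ⟨x, hx⟩ => hξ x hx
    have := (AddSubgroup.add_mem_iff_of_index_two h22 (a := c) (b := ξ)).mpr (by tauto)
    obtain ⟨x, hx⟩ := this
    refine ⟨x, Or.inr ?_⟩
    have hx : x ^ 2 + x = c + ξ := hx
    rw [hx, add_assoc, CharTwo.add_self_eq_zero, add_zero]

lemma monomial_mem [Finite F] {ξ : F} (hξ : ∀ x : F, x ^ 2 + x ≠ ξ) (n : ℕ) :
    ∀ c : F, ι (C c * X ^ n) ∈ H ξ := by
  induction n using Nat.strong_induction_on with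
  | _ n ih =>
    intro c
    rcases Nat.even_or_odd' n with ⟨m, rfl | rfl⟩
    · rcases Nat.eq_zero_or_pos m with rfl | hm
      · obtain ⟨x, h | h⟩ := const_cases hξ c
        · have := wp_mem (ξ := ξ) (ι (C x))
          simpa [h] using this
        · have := (H ξ).add_mem (wp_mem (ξ := ξ) (ι (C x))) (gens_mem (Or.inr (Or.inr rfl)))
          simpa [h] using this
      · obtain ⟨b, hb⟩ := exists_sq c
        have := sq_mem (ih m (by omega) b)
        rw [← map_pow] at this
        convert this using 2
        rw [mul_pow, ← hb, C_pow]; ring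
    · exact gens_mem (Or.inr (Or.inl ⟨c, m + 1, by omega, by congr 3⟩))

lemma poly_mem [Finite F] {ξ : F} (hξ : ∀ x : F, x ^ 2 + x ≠ ξ) (p : Polynomial F) :
    ι p ∈ H ξ := by
  induction p using Polynomial.induction_on' with
  | add p q hp hq => rw [map_add]; exact (H ξ).add_mem hp hq
  | monomial n a => rw [← C_mul_X_pow_eq_monomial]; exact monomial_mem hξ n a

lemma exists_sq_mod [Finite F] {P : Polynomial F} (hm : P.Monic) (hi : Irreducible P) (Q : Polynomial F) :
    ∃ R t : Polynomial F, Q = R ^ 2 + P * t := by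
  have : Fact (Irreducible P) := ⟨hi⟩
  have : Module.Finite F (AdjoinRoot P) := hm.finite_adjoinRoot
  have : Finite (AdjoinRoot P) := Module.finite_of_finite F
  have : CharP (AdjoinRoot P) 2 := charP_of_injective_algebraMap (algebraMap F (AdjoinRoot P)).injective 2
  obtain ⟨b, hb⟩ := exists_sq (AdjoinRoot.mk P Q)
  obtain ⟨R, rfl⟩ := AdjoinRoot.mk_surjective b
  rw [← map_pow, eq_comm, AdjoinRoot.mk_eq_mk] at hb
  obtain ⟨t, ht⟩ := hb
  exact ⟨R, t, by rw [← ht]; ring⟩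

lemma prime_pow_mem [Finite F] {ξ : F} (hξ : ∀ x : F, x ^ 2 + x ≠ ξ) {P : Polynomial F}
    (hm : P.Monic) (hi : Irreducible P) (k : ℕ) :
    ∀ p, ι p / ι P ^ k ∈ H ξ := by
  have hP : ι P ≠ 0 := by simpa using hi.ne_zero
  induction k using Nat.strong_induction_on with
  | _ k ih =>
    intro p
    rcases Nat.even_or_odd' k with ⟨m, rfl | rfl⟩
    · rcases Nat.eq_zero_or_pos m with rfl | hpos
      · simpa using poly_mem hξ p
      · obtain ⟨R, t, rfl⟩ := exists_sq_mod hm hi p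
        have h1 := sq_mem (ih m (by omega) R)
        have h2 := ih (2 * m - 1) (by omega) t
        have := (H ξ).add_mem h1 h2
        convert this using 1
        obtain ⟨s, rfl⟩ : ∃ s, m = s + 1 := ⟨m - 1, by omega⟩
        rw [show 2 * (s + 1) - 1 = 2 * s + 1 by omega]
        simp only [map_add, map_mul, map_pow]
        field_simp
        ring
    · have h1 : ι (p %ₘ P) / ι P ^ (2 * m + 1) ∈ H ξ := gens_mem
        (Or.inl ⟨P, p %ₘ P, m + 1, hm, hi, degree_modByMonic_lt _ hm, by omega, by congr 2⟩)
      have h2 := ih (2 * m) (by omega) (p /ₘ P)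
      have := (H ξ).add_mem h1 h2
      convert this using 1
      conv_lhs => rw [← modByMonic_add_div p P]
      simp only [map_add, map_mul]
      field_simp
      ring

lemma all_mem [Finite F] {ξ : F} (hξ : ∀ x : F, x ^ 2 + x ≠ ξ) (u : RatFunc F) : u ∈ H ξ := by
  have key : ∀ d : Polynomial F, ∀ p, ι p / ι d ∈ H ξ := by
    intro d
    induction d using UniqueFactorizationMonoid.induction_on_coprime with
    | h0 => intro p; simp [(H ξ).zero_mem]
    | h1 hu =>
      intro p
      obtain ⟨v, rfl⟩ := hu
      have := poly_mem hξ (p * (v⁻¹ : (Polynomial F)ˣ))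
      convert this using 1
      have hv : ι (v : Polynomial F) ≠ 0 := by simp
      rw [div_eq_iff hv, ← map_mul]; simp [mul_assoc]
    | hpr i hp =>
      rename_i q
      intro p
      have hi : Irreducible q := hp.irreducible
      have hl : q.leadingCoeff ≠ 0 := by simpa using hi.ne_zero
      have := prime_pow_mem hξ (monic_mul_leadingCoeff_inv hi.ne_zero)
        (irreducible_mul_leadingCoeff_inv.mpr hi) i (p * C (q.leadingCoeff⁻¹) ^ i)
      convert this using 1
      have hq : ι q ≠ 0 := by simpa using hi.ne_zero
      have hl' : ι (C q.leadingCoeff⁻¹) ≠ 0 := by simpa using hl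
      simp only [map_mul, map_pow, mul_pow]
      rw [mul_div_mul_right _ _ (pow_ne_zero i hl')]
    | hcp h hx hy =>
      rename_i x y
      intro p
      by_cases hx0 : x = 0
      · simp [hx0, (H ξ).zero_mem]
      by_cases hy0 : y = 0
      · simp [hy0, (H ξ).zero_mem]
      obtain ⟨a, b, hab⟩ := h.isCoprime
      have := (H ξ).add_mem (hx (p * b)) (hy (p * a))
      convert this using 1
      have h1 : ι x ≠ 0 := by simpa using hx0
      have h2 : ι y ≠ 0 := by simpa using hy0
      conv_lhs => rw [← mul_one p, ← hab]
      simp only [map_mul, map_add]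
      field_simp
      ring
  have := key u.denom u.num
  rwa [RatFunc.num_div_denom] at this

/-- Normalized forms without nonvanishing conditions on leading coefficients. -/
def Weak (ξ : F) (v : RatFunc F) : Prop :=
  ∃ (S₀ : Finset (Polynomial F)) (N₀ : ℕ) (Q : Polynomial F → ℕ → Polynomial F) (a : ℕ → F) (α : F),
    (∀ P ∈ S₀, P.Monic ∧ Irreducible P) ∧
    (∀ P ∈ S₀, ∀ j, (Q P j).degree < P.degree) ∧ (∀ P ∉ S₀, ∀ j, Q P j = 0) ∧
    (α = 0 ∨ α = ξ) ∧
    ∀ S, S₀ ⊆ S → ∀ N, N₀ ≤ N →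
      v = (∑ P ∈ S, ∑ j ∈ Finset.Icc 1 N, ι (Q P j) / ι P ^ (2 * j - 1)) +
          ι ((∑ l ∈ Finset.Icc 1 N, C (a l) * X ^ (2 * l - 1)) + C α)

lemma Weak.add {ξ : F} {v w : RatFunc F} (hv : Weak ξ v) (hw : Weak ξ w) : Weak ξ (v + w) := by
  classical
  obtain ⟨S, N, Q, a, α, h1, h2, h3, h4, h5⟩ := hv
  obtain ⟨S', N', Q', a', α', h1', h2', h3', h4', h5'⟩ := hw
  refine ⟨S ∪ S', max N N', fun P j => Q P j + Q' P j, fun l => a l + a' l, α + α', ?_, ?_, ?_, ?_, ?_⟩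
  · intro P hP
    rcases Finset.mem_union.mp hP with h | h
    exacts [h1 P h, h1' P h]
  · intro P hP j
    have hirr : Irreducible P := by
      rcases Finset.mem_union.mp hP with h | h
      exacts [(h1 P h).2, (h1' P h).2]
    have hbot : (⊥ : WithBot ℕ) < P.degree := bot_lt_iff_ne_bot.mpr (by simpa using hirr.ne_zero)
    have e1 : (Q P j).degree < P.degree := by
      by_cases h : P ∈ S
      · exact h2 P h j
      · rw [h3 P h]; simpa using hbot
    have e2 : (Q' P j).degree < P.degree := by
      by_cases h : P ∈ S'
      · exact h2' P h j
      · rw [h3' P h]; simpa using hbot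
    exact (degree_add_le _ _).trans_lt (max_lt e1 e2)
  · intro P hP j
    simp only [Finset.mem_union, not_or] at hP
    simp [h3 P hP.1, h3' P hP.2]
  · rcases h4 with rfl | rfl <;> rcases h4' with rfl | rfl <;> simp [CharTwo.add_self_eq_zero]
  · intro T hT M hM
    rw [h5 T (Finset.union_subset_left hT) M (le_of_max_le_left hM),
      h5' T (Finset.union_subset_right hT) M (le_of_max_le_right hM)]
    simp only [map_add, add_mul, add_div, Finset.sum_add_distrib]
    ring

lemma Weak.zero (ξ : F) : Weak ξ 0 :=
  ⟨∅, 0, fun _ _ => 0, fun _ => 0, 0, by simp, by simp, by simp, by simp, by simp⟩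

lemma weak_of_closure {ξ : F} {v : RatFunc F} (hv : v ∈ AddSubgroup.closure (gens ξ)) :
    Weak ξ v := by
  classical
  induction hv using AddSubgroup.closure_induction with
  | zero => exact Weak.zero ξ
  | add x y _ _ hx hy => exact hx.add hy
  | neg x _ hx =>
    have : CharP (RatFunc F) 2 := charP_of_injective_algebraMap (algebraMap F (RatFunc F)).injective 2
    rwa [CharTwo.neg_eq]
  | mem x hx =>
    rcases hx with ⟨P, R, j, hm, hi, hd, hj, rfl⟩ | ⟨c, l, hl, rfl⟩ | rfl
    · refine ⟨{P}, j, fun P' j' => if P' = P ∧ j' = j then R else 0, fun _ => 0, 0, ?_, ?_, ?_, ?_, ?_⟩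
      · simp [hm, hi]
      · intro P' hP' j'
        rw [Finset.mem_singleton] at hP'
        subst hP'
        dsimp only
        split_ifs
        · exact hd
        · rw [degree_zero]; exact bot_lt_iff_ne_bot.mpr (by simpa using hi.ne_zero)
      · intro P' hP' j'
        rw [Finset.mem_singleton] at hP'
        simp [hP']
      · simp
      · intro S hS N hN
        rw [Finset.sum_eq_single P, Finset.sum_eq_single j]
        · simp
        · intro b _ hb; simp [hb]
        · intro h; exact absurd (Finset.mem_Icc.mpr ⟨hj, hN⟩) h
        · intro b _ hb; simp [hb]
        · intro h; exact absurd (hS (Finset.mem_singleton_self P)) h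
    · refine ⟨∅, l, fun _ _ => 0, fun l' => if l' = l then c else 0, 0, by simp, by simp, by simp,
        by simp, ?_⟩
      intro S hS N hN
      rw [Finset.sum_eq_single (s := Finset.Icc 1 N) l]
      · simp
      · intro b _ hb; simp [hb]
      · intro h; exact absurd (Finset.mem_Icc.mpr ⟨hl, hN⟩) h
    · exact ⟨∅, 0, fun _ _ => 0, fun _ => 0, ξ, by simp, by simp, by simp, by simp, by simp⟩

/-- Trimming a finite range to the last index satisfying a predicate. -/
lemma exists_trim (p : ℕ → Prop) (N : ℕ) :
    ∃ n, n ≤ N ∧ (0 < n → p n) ∧ ∀ j, n < j → j ≤ N → ¬ p j := by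
  induction N with
  | zero => exact ⟨0, le_rfl, by simp, by intros; omega⟩
  | succ N ih =>
    by_cases h : p (N + 1)
    · exact ⟨N + 1, le_rfl, fun _ => h, by intros; omega⟩
    · obtain ⟨n, h1, h2, h3⟩ := ih
      refine ⟨n, by omega, h2, fun j hj hj' => ?_⟩
      rcases Nat.lt_or_ge N j with h' | h'
      · obtain rfl : j = N + 1 := by omega
        exact h
      · exact h3 j hj h'

lemma normal_of_weak {ξ : F} {v : RatFunc F} (hv : Weak ξ v) : v ∈ NormalForm ξ := by
  classical
  obtain ⟨S, N, Q, a, α, h1, h2, h3, h4, h5⟩ := hv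
  have h5 := h5 S (Finset.Subset.refl _) N le_rfl
  choose e he1 he2 he3 using fun P => exists_trim (fun j => Q P j ≠ 0) N
  obtain ⟨n, hn1, hn2, hn3⟩ := exists_trim (fun j => a j ≠ 0) N
  refine ⟨S.filter (fun P => 1 ≤ e P), e, Q, n, a, α, ?_, ?_, ?_, ?_, h4, hn2, ?_⟩
  · intro P hP; exact h1 P (Finset.mem_filter.mp hP).1
  · intro P hP; exact (Finset.mem_filter.mp hP).2
  · intro P hP j _ _; exact h2 P (Finset.mem_filter.mp hP).1 j
  · intro P hP; exact he2 P (Finset.mem_filter.mp hP).2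
  · have e1 : ∑ l ∈ Finset.Icc 1 n, C (a l) * X ^ (2 * l - 1) =
        ∑ l ∈ Finset.Icc 1 N, C (a l) * X ^ (2 * l - 1) := by
      apply Finset.sum_subset (Finset.Icc_subset_Icc_right hn1)
      intro j hj hj'
      simp only [Finset.mem_Icc] at hj hj'
      have := hn3 j (by omega) (by omega)
      rw [not_not] at this
      simp [this]
    rw [h5, e1]
    congr 1
    rw [Finset.sum_filter]
    apply Finset.sum_congr rfl
    intro P _
    have e2 : ∑ j ∈ Finset.Icc 1 (e P), ι (Q P j) / ι P ^ (2 * j - 1) =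
        ∑ j ∈ Finset.Icc 1 N, ι (Q P j) / ι P ^ (2 * j - 1) := by
      apply Finset.sum_subset (Finset.Icc_subset_Icc_right (he1 P))
      intro j hj hj'
      simp only [Finset.mem_Icc] at hj hj'
      have := he3 P j (by omega) (by omega)
      rw [not_not] at this
      simp [this]
    rw [← e2]
    split_ifs with h
    · rfl
    · rw [Finset.Icc_eq_empty h]; simp

lemma closure_of_normal {ξ : F} {v : RatFunc F} (hv : v ∈ NormalForm ξ) :
    v ∈ AddSubgroup.closure (gens ξ) := by
  obtain ⟨S, e, Q, n, a, α, h1, h2, h3, h4, h5, h6, rfl⟩ := hv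
  refine AddSubgroup.add_mem _ (AddSubgroup.sum_mem _ fun P hP => AddSubgroup.sum_mem _ fun j hj => ?_) ?_
  · rw [Finset.mem_Icc] at hj
    exact AddSubgroup.subset_closure (Or.inl ⟨P, Q P j, j, (h1 P hP).1, (h1 P hP).2,
      h3 P hP j hj.1 hj.2, hj.1, rfl⟩)
  · rw [map_add, map_sum]
    refine AddSubgroup.add_mem _ (AddSubgroup.sum_mem _ fun l hl => ?_) ?_
    · rw [Finset.mem_Icc] at hl
      exact AddSubgroup.subset_closure (Or.inr (Or.inl ⟨a l, l, hl.1, rfl⟩))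
    · rcases h5 with rfl | rfl
      · simp
      · exact AddSubgroup.subset_closure (Or.inr (Or.inr rfl))

open IsDedekindDomain WithZero in
lemma no_pole (P : Polynomial F) (hPm : P.Monic) (hP : Irreducible P) (S : Finset (Polynomial F))
    (e : Polynomial F → ℕ) (Q : Polynomial F → ℕ → Polynomial F) (r : Polynomial F) (w : RatFunc F)
    (h1 : ∀ P ∈ S, P.Monic ∧ Irreducible P) (h2 : 1 ≤ e P)
    (h3 : (Q P (e P)).degree < P.degree) (h4 : Q P (e P) ≠ 0) (hPS : P ∈ S)
    (hw : (∑ P ∈ S, ∑ j ∈ Finset.Icc 1 (e P), ι (Q P j) / ι P ^ (2 * j - 1)) + ι r = w ^ 2 + w) :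
    False := by
  classical
  have hprime : Prime P := hP.prime
  let 𝔭 : HeightOneSpectrum (Polynomial F) := ⟨Ideal.span {P},
    (Ideal.span_singleton_prime hP.ne_zero).mpr hprime, by simpa using hP.ne_zero⟩
  let V := 𝔭.valuation (RatFunc F)
  have hmem : ∀ x : Polynomial F, x ∈ 𝔭.asIdeal ↔ P ∣ x := fun x => Ideal.mem_span_singleton
  have hVle : ∀ x, V (ι x) ≤ 1 := fun x => 𝔭.valuation_le_one x
  have hV1 : ∀ x, ¬ P ∣ x → V (ι x) = 1 := fun x hx =>
    (𝔭.valuation_eq_one_iff_notMem).mpr (by rwa [hmem])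
  have hVP : V (ι P) = exp (-1 : ℤ) := by
    rw [show V (ι P) = _ from 𝔭.valuation_of_algebraMap P]
    exact 𝔭.intValuation_singleton hP.ne_zero rfl
  have hVPk : ∀ k : ℕ, V (ι P ^ k) = exp (-(k : ℤ)) := by
    intro k; rw [map_pow, hVP, ← exp_nsmul]; simp
  have hbig : (1 : ℤᵐ⁰) < exp ((2 * e P - 1 : ℕ) : ℤ) := by
    rw [← exp_zero, exp_lt_exp]; omega
  have hne : (exp ((2 * e P - 1 : ℕ) : ℤ) : ℤᵐ⁰) ≠ 0 := by simp
  have hQ : ¬ P ∣ Q P (e P) := fun h => absurd (degree_le_of_dvd h h4) (not_le.mpr h3)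
  have hmain : V (ι (Q P (e P)) / ι P ^ (2 * e P - 1)) = exp ((2 * e P - 1 : ℕ) : ℤ) := by
    rw [map_div₀, hV1 _ hQ, hVPk, exp_neg]; simp
  have hlow : V ((∑ j ∈ (Finset.Icc 1 (e P)).erase (e P), ι (Q P j) / ι P ^ (2 * j - 1)) +
      ((∑ P' ∈ S.erase P, ∑ j ∈ Finset.Icc 1 (e P'), ι (Q P' j) / ι P' ^ (2 * j - 1)) + ι r))
      < exp ((2 * e P - 1 : ℕ) : ℤ) := by
    refine V.map_add_lt (V.map_sum_lt hne fun j hj => ?_) (V.map_add_lt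
      (V.map_sum_lt hne fun P' hP' => V.map_sum_lt hne fun j hj => ?_) ((hVle r).trans_lt hbig))
    · rw [Finset.mem_erase, Finset.mem_Icc] at hj
      rw [map_div₀, hVPk, exp_neg, div_inv_eq_mul]
      calc V (ι (Q P j)) * exp ((2 * j - 1 : ℕ) : ℤ) ≤ 1 * exp ((2 * j - 1 : ℕ) : ℤ) := by
            gcongr; exact hVle _
        _ < _ := by rw [one_mul, exp_lt_exp]; omega
    · rw [Finset.mem_erase] at hP'
      have : ¬ P ∣ P' := fun h => hP'.1
        (eq_of_monic_of_associated (h1 P' hP'.2).1 hPm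
          (hP.associated_of_dvd (h1 P' hP'.2).2 h).symm)
      rw [map_div₀, map_pow, hV1 _ this, one_pow, div_one]
      exact (hVle _).trans_lt hbig
  have htot : V (w ^ 2 + w) = exp ((2 * e P - 1 : ℕ) : ℤ) := by
    rw [← hw, ← Finset.add_sum_erase S _ hPS,
      ← Finset.add_sum_erase (Finset.Icc 1 (e P)) _ (Finset.mem_Icc.mpr ⟨h2, le_rfl⟩),
      add_assoc, add_assoc, V.map_add_eq_of_lt_left (by rw [hmain]; exact hlow), hmain]
  rcases le_or_gt (V w) 1 with h | h
  · have : V (w ^ 2 + w) ≤ 1 := V.map_add_le (by rw [map_pow]; exact pow_le_one' h 2) h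
    rw [htot] at this
    exact absurd hbig (not_lt.mpr this)
  · have hlt : V w < V (w ^ 2) := by
      rw [map_pow, sq]
      exact lt_mul_of_one_lt_left (zero_lt_one.trans h) h
    rw [V.map_add_eq_of_lt_left hlt, map_pow] at htot
    have hw0 : V w ≠ 0 := (zero_lt_one.trans h).ne'
    rw [← exp_log hw0, ← exp_nsmul, exp_inj] at htot
    simp only [nsmul_eq_mul, Nat.cast_ofNat] at htot
    omega

lemma normal_wp_eq_zero {ξ : F} (hξ : ∀ x : F, x ^ 2 + x ≠ ξ) {v w : RatFunc F}
    (hv : v ∈ NormalForm ξ) (hw : v = w ^ 2 + w) : v = 0 := by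
  obtain ⟨S, e, Q, n, a, α, h1, h2, h3, h4, h5, h6, h7⟩ := hv
  have hS : S = ∅ := by
    rw [Finset.eq_empty_iff_forall_notMem]
    intro P hP
    exact no_pole P (h1 P hP).1 (h1 P hP).2 S e Q _ w h1 (h2 P hP) (h3 P hP _ (h2 P hP) le_rfl)
      (h4 P hP) hP (h7.symm.trans hw)
  subst hS
  rw [Finset.sum_empty, zero_add] at h7
  set r := (∑ l ∈ Finset.Icc 1 n, C (a l) * X ^ (2 * l - 1)) + C α with hr
  have hint : IsIntegral (Polynomial F) w := by
    refine ⟨X ^ 2 + X - C r, ?_, ?_⟩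
    · monicity!
    · simp [← hw, ← h7]
  obtain ⟨y, rfl⟩ := IsIntegrallyClosed.algebraMap_eq_of_integral hint
  have hy : r = y ^ 2 + y := by
    apply IsFractionRing.injective (Polynomial F) (RatFunc F)
    rw [← h7, hw]; simp
  have hdeg : 0 < y.natDegree → r.natDegree = 2 * y.natDegree := by
    intro h
    rw [hy, natDegree_add_eq_left_of_natDegree_lt, natDegree_pow]
    rw [natDegree_pow]; omega
  have hn : n = 0 := by
    by_contra hn
    have hn' : 0 < n := Nat.pos_of_ne_zero hn
    have hrd : r.natDegree = 2 * n - 1 := by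
      apply natDegree_eq_of_le_of_coeff_ne_zero
      · rw [hr]
        refine natDegree_add_le_of_degree_le (natDegree_sum_le_of_forall_le _ _ fun l hl => ?_) (by simp)
        rw [Finset.mem_Icc] at hl
        exact (natDegree_C_mul_X_pow_le _ _).trans (by omega)
      · rw [hr, coeff_add, finset_sum_coeff, Finset.sum_eq_single n]
        · rw [coeff_C_mul_X_pow, if_pos rfl, coeff_C, if_neg (by omega), add_zero]
          exact h6 hn'
        · intro b hb hbn
          rw [Finset.mem_Icc] at hb
          rw [coeff_C_mul_X_pow, if_neg (by omega)]
        · intro h; exact absurd (Finset.mem_Icc.mpr ⟨hn', le_rfl⟩) h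
    rcases Nat.eq_zero_or_pos y.natDegree with h0 | h0
    · have : r.natDegree ≤ 0 := by
        rw [hy]
        refine natDegree_add_le_of_degree_le ?_ h0.le
        rw [natDegree_pow]; omega
      omega
    · have := hdeg h0
      omega
  subst hn
  have hrα : r = C α := by rw [hr]; simp
  rcases h5 with rfl | rfl
  · rw [h7, hrα]; simp
  · exfalso
    rw [hrα] at hy
    apply hξ (y.eval 0)
    have := congrArg (eval 0) hy
    simpa using this.symm

end

/-- Lemma 2.2: every `u ∈ k` is equivalent modulo `℘(k) = {w² + w : w ∈ k}` to a
unique element in normalized form. -/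
theorem statement0 {Fq : Type} [Field Fq] [Fintype Fq] (hchar : ringChar Fq = 2)
    (ξ : Fq) (hξ : ∀ x : Fq, x ^ 2 + x ≠ ξ) (u : RatFunc Fq) :
    ∃! v : RatFunc Fq, v ∈ NormalForm ξ ∧ ∃ w : RatFunc Fq, u - v = w ^ 2 + w := by
  have hF : CharP Fq 2 := by rw [← hchar]; exact ringChar.charP Fq
  have hR : CharP (RatFunc Fq) 2 :=
    charP_of_injective_algebraMap (algebraMap Fq (RatFunc Fq)).injective 2
  obtain ⟨g, hg, z, ⟨w, rfl⟩, hz⟩ := AddSubgroup.mem_sup.mp (all_mem hξ u)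
  refine ⟨g, ⟨normal_of_weak (weak_of_closure hg), w, ?_⟩, ?_⟩
  · rw [← hz, add_sub_cancel_left]; rfl
  · rintro v ⟨hv, w', hw'⟩
    have hmem : v - g ∈ NormalForm ξ := normal_of_weak (weak_of_closure
      (AddSubgroup.sub_mem _ (closure_of_normal hv) hg))
    have hw : g + (w ^ 2 + w) = u := hz
    refine sub_eq_zero.mp (normal_wp_eq_zero hξ hmem (w := w - w') ?_)
    rw [CharTwo.sub_eq_add w w', CharTwo.add_sq]
    have : v - g = (w ^ 2 + w) - (w' ^ 2 + w') := by rw [← hw', ← hw]; ring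
    rw [this, CharTwo.sub_eq_add]; ring

end EvenChar
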